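/- arXiv:2201.13170 — 6 statements merged into one kernel-verified Lean document; each statement's English description precedes it below -/
import Mathlib

section
/- For every natural number m ≥ 1 and every real number x with 0 < x < 1, it holds that x / (1 - (1-x)^m) ≤ 1/m + x. -/
theorem one_add_mul_mul_one_sub_pow_le_one (m : ℕ) {x : ℝ} (hx1 : x ≤ 1) :
    (1 + m * x) * (1 - x) ^ m ≤ 1 := by
  induction m with
  | zero => simp
  | succ k ih =>
    refine le_trans ?_ ih
    have hp : 0 ≤ (1 - x) ^ k := pow_nonneg (sub_nonneg.2 hx1) k
    have h : (1 + (k + 1 : ℝ) * x) * (1 - x) ≤ 1 + k * x := by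
      have : 0 ≤ (k + 1 : ℝ) * x ^ 2 := by positivity
      linarith
    calc (1 + ((k + 1 : ℕ) : ℝ) * x) * (1 - x) ^ (k + 1)
        = ((1 + (k + 1 : ℝ) * x) * (1 - x)) * (1 - x) ^ k := by push_cast; ring
      _ ≤ (1 + k * x) * (1 - x) ^ k := mul_le_mul_of_nonneg_right h hp

theorem stmt_0 (m : ℕ) (hm : 1 ≤ m) (x : ℝ) (hx0 : 0 < x) (hx1 : x < 1) :
    x / (1 - (1 - x) ^ m) ≤ 1 / m + x := by
  have hm0 : (0 : ℝ) < m := by exact_mod_cast hm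
  have hd : 0 < 1 - (1 - x) ^ m :=
    sub_pos.2 (pow_lt_one₀ (by linarith) (by linarith) (by omega))
  have key := one_add_mul_mul_one_sub_pow_le_one m hx1.le
  have he : 1 / (m : ℝ) + x = (1 + m * x) / m := by field_simp
  rw [he, div_le_div_iff₀ hd hm0]
  linarith
end

section
/- Let m ≥ 1 be a natural number, let π and q be real numbers with 0 ≤ π and 0 ≤ q, and let p_0, p_1, ..., p_m be nonnegative real numbers with ∑_{i=0}^m p_i = 1 and ∑_{i=0}^m i·p_i = m·q. Then ∑_{i=0}^m p_i · (i·π)/(1 + i·π) ≥ m·q·π/(1 + m·π). -/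
theorem stmt_3 (m : ℕ) (hm : 1 ≤ m) (π q : ℝ) (hπ : 0 ≤ π) (hq : 0 ≤ q)
    (p : ℕ → ℝ) (hp : ∀ i ∈ Finset.range (m + 1), 0 ≤ p i)
    (hsum : ∑ i ∈ Finset.range (m + 1), p i = 1)
    (hmean : ∑ i ∈ Finset.range (m + 1), (i : ℝ) * p i = m * q) :
    ∑ i ∈ Finset.range (m + 1), p i * ((i : ℝ) * π / (1 + i * π))
      ≥ m * q * π / (1 + m * π) := by
  rw [ge_iff_le, ← hmean, Finset.sum_mul, Finset.sum_div]
  refine Finset.sum_le_sum fun i hi => ?_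
  have him : (i : ℝ) ≤ m := by exact_mod_cast Nat.lt_succ_iff.mp (Finset.mem_range.mp hi)
  have hpi := hp i hi
  calc (i : ℝ) * p i * π / (1 + m * π) = p i * (i * π / (1 + m * π)) := by ring
    _ ≤ p i * (i * π / (1 + i * π)) := by gcongr
end

section
/- Let m ≥ 1 be a natural number, let π be a real number with 0 ≤ π ≤ 1, let q ≥ 0 be real, and let p_0, p_1, ..., p_m be nonnegative real numbers with ∑_{i=0}^m p_i = 1 and ∑_{i=0}^m i·p_i = m·q. Then ∑_{i=0}^m p_i · (1 - (1-π)^i) ≥ m·q·π/(1 + m·π). -/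
theorem one_sub_pow_mul_one_add_mul_le_one {x : ℝ} (hx1 : x ≤ 1) (n : ℕ) :
    (1 - x) ^ n * (1 + n * x) ≤ 1 := by
  induction n with
  | zero => simp
  | succ n ih =>
    calc (1 - x) ^ (n + 1) * (1 + (n + 1 : ℕ) * x)
        = (1 - x) ^ n * (1 + n * x - (n + 1) * x ^ 2) := by push_cast; ring
      _ ≤ (1 - x) ^ n * (1 + n * x) :=
        mul_le_mul_of_nonneg_left (sub_le_self _ (by positivity)) (pow_nonneg (by linarith) n)
      _ ≤ 1 := ih

theorem mul_div_one_add_mul_le_one_sub_pow {x : ℝ} (hx0 : 0 ≤ x) (hx1 : x ≤ 1) (n : ℕ) :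
    n * x / (1 + n * x) ≤ 1 - (1 - x) ^ n := by
  rw [div_le_iff₀ (by positivity)]
  linarith [one_sub_pow_mul_one_add_mul_le_one hx1 n]

theorem stmt_4 (m : ℕ) (hm : 1 ≤ m) (π q : ℝ) (hπ0 : 0 ≤ π) (hπ1 : π ≤ 1) (hq : 0 ≤ q)
    (p : ℕ → ℝ) (hp : ∀ i ∈ Finset.range (m + 1), 0 ≤ p i)
    (hsum : ∑ i ∈ Finset.range (m + 1), p i = 1)
    (hmean : ∑ i ∈ Finset.range (m + 1), (i : ℝ) * p i = m * q) :
    ∑ i ∈ Finset.range (m + 1), p i * (1 - (1 - π) ^ i)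
      ≥ m * q * π / (1 + m * π) := by
  rw [← hmean, Finset.sum_mul, Finset.sum_div]
  refine Finset.sum_le_sum fun i hi => ?_
  have him : (i : ℝ) ≤ m := by exact_mod_cast Finset.mem_range_succ_iff.mp hi
  calc (i : ℝ) * p i * π / (1 + m * π) = p i * (i * π / (1 + m * π)) := by ring
    _ ≤ p i * (i * π / (1 + i * π)) := by
      have := hp i hi
      gcongr
    _ ≤ p i * (1 - (1 - π) ^ i) :=
      mul_le_mul_of_nonneg_left (mul_div_one_add_mul_le_one_sub_pow hπ0 hπ1 i) (hp i hi)
end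

section
/- Let n be a natural number and p a real number with 0 < p ≤ 1 and n ≥ 1/p². Then ∑_{k=0}^{n} (n choose k) · p^k · (1-p)^{n-k} · √k ≥ 0.01 · √(n·p). -/
/-- A quadratic minorant (in `x`) of `√x`, touching it at `x = m`. -/
lemma sqrt_mul_quadratic_le_sq_mul_sqrt {m x : ℝ} (hm : 0 ≤ m) (hx : 0 ≤ x) :
    √m * (m ^ 2 / 2 + m * x / 2 - (m - x) ^ 2 / 2) ≤ m ^ 2 * √x := by
  obtain ⟨r, hr, rfl⟩ : ∃ r : ℝ, 0 ≤ r ∧ m = r ^ 2 := ⟨√m, m.sqrt_nonneg, (Real.sq_sqrt hm).symm⟩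
  obtain ⟨t, ht, rfl⟩ : ∃ t : ℝ, 0 ≤ t ∧ x = t ^ 2 := ⟨√x, x.sqrt_nonneg, (Real.sq_sqrt hx).symm⟩
  rw [Real.sqrt_sq hr, Real.sqrt_sq ht]
  have h : 0 ≤ r * t * (r - t) ^ 2 * (t + 2 * r) := by positivity
  linarith

theorem stmt_5 (n : ℕ) (p : ℝ) (hp0 : 0 < p) (hp1 : p ≤ 1) (hn : (n : ℝ) ≥ 1 / p ^ 2) :
    ∑ k ∈ Finset.range (n + 1),
        (n.choose k : ℝ) * p ^ k * (1 - p) ^ (n - k) * Real.sqrt k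
      ≥ 0.01 * Real.sqrt (n * p) := by
  have h0 := congrArg (Polynomial.eval p) (bernsteinPolynomial.sum ℝ n)
  have h1 := congrArg (Polynomial.eval p) (bernsteinPolynomial.sum_smul ℝ n)
  have h2 := congrArg (Polynomial.eval p) (bernsteinPolynomial.variance ℝ n)
  simp only [bernsteinPolynomial, Polynomial.eval_finsetSum, nsmul_eq_mul, Polynomial.eval_mul,
    Polynomial.eval_pow, Polynomial.eval_sub, Polynomial.eval_X, Polynomial.eval_one,
    Polynomial.eval_natCast] at h0 h1 h2
  have hm : 1 ≤ n * p := by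
    rw [ge_iff_le, div_le_iff₀ (by positivity)] at hn
    nlinarith [mul_nonneg (Nat.cast_nonneg (α := ℝ) n) hp0.le]
  set m : ℝ := n * p
  set w : ℕ → ℝ := fun k ↦ (n.choose k : ℝ) * p ^ k * (1 - p) ^ (n - k)
  have hw0 (k : ℕ) : 0 ≤ w k := by
    have := sub_nonneg.2 hp1
    positivity
  have key : √m * (m ^ 2 / 2 + m * m / 2 - m * (1 - p) / 2) ≤
      m ^ 2 * ∑ k ∈ Finset.range (n + 1), w k * √k := by
    calc √m * (m ^ 2 / 2 + m * m / 2 - m * (1 - p) / 2)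
        = √m * (m ^ 2 / 2 * ∑ k ∈ Finset.range (n + 1), w k
            + m / 2 * ∑ k ∈ Finset.range (n + 1), k * w k
            - (∑ k ∈ Finset.range (n + 1), (m - k) ^ 2 * w k) / 2) := by
          rw [h0, h1, h2]; ring
      _ = ∑ k ∈ Finset.range (n + 1),
            w k * (√m * (m ^ 2 / 2 + m * k / 2 - (m - k) ^ 2 / 2)) := by
          simp only [Finset.mul_sum, Finset.sum_div, ← Finset.sum_add_distrib,
            ← Finset.sum_sub_distrib]
          exact Finset.sum_congr rfl fun k _ ↦ by ring
      _ ≤ ∑ k ∈ Finset.range (n + 1), w k * (m ^ 2 * √k) :=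
          Finset.sum_le_sum fun k _ ↦ mul_le_mul_of_nonneg_left
            (sqrt_mul_quadratic_le_sq_mul_sqrt (by linarith) k.cast_nonneg) (hw0 k)
      _ = m ^ 2 * ∑ k ∈ Finset.range (n + 1), w k * √k := by
          rw [Finset.mul_sum]
          exact Finset.sum_congr rfl fun k _ ↦ by ring
  have hlow : m ^ 2 * (0.01 * √m) ≤ √m * (m ^ 2 / 2 + m * m / 2 - m * (1 - p) / 2) := by
    rw [mul_comm (0.01 : ℝ), mul_left_comm]
    refine mul_le_mul_of_nonneg_left ?_ m.sqrt_nonneg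
    nlinarith [mul_nonneg (zero_le_one.trans hm) hp0.le]
  exact le_of_mul_le_mul_left (hlow.trans key) (by positivity)
end

section
/- Let n be a natural number and p a real number with 0 < p ≤ 1 and n ≥ 1/p². Then ∑_{k=0}^{n} [k < n·p/100] · (n choose k) · p^k · (1-p)^{n-k} ≤ 9/10, where [k < n·p/100] is 1 if k < n·p/100 and 0 otherwise. -/
/-- Chernoff's bound for the lower tail of a binomial distribution. -/
theorem binomial_lower_tail_le_exp (n : ℕ) {p s : ℝ} (hp0 : 0 ≤ p) (hp1 : p ≤ 1) (hs : 0 ≤ s)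
    (a : ℝ) :
    ∑ k ∈ Finset.range (n + 1),
        (if (k : ℝ) < a then (1 : ℝ) else 0) *
          ((n.choose k : ℝ) * p ^ k * (1 - p) ^ (n - k))
      ≤ Real.exp (s * a - n * p * (1 - Real.exp (-s))) := by
  have hq : 0 ≤ 1 - p := sub_nonneg.2 hp1
  calc
    _ ≤ ∑ k ∈ Finset.range (n + 1),
        Real.exp (s * a - s * k) * ((n.choose k : ℝ) * p ^ k * (1 - p) ^ (n - k)) := by
      gcongr with k _
      split_ifs with h
      · exact Real.one_le_exp (by nlinarith)
      · positivity
    _ = Real.exp (s * a) * (p * Real.exp (-s) + (1 - p)) ^ n := by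
      rw [add_pow, Finset.mul_sum]
      refine Finset.sum_congr rfl fun k _ => ?_
      rw [mul_pow, ← Real.exp_nat_mul, sub_eq_add_neg (s * a), Real.exp_add,
        show -(s * k) = k * -s by ring]
      ring
    _ ≤ Real.exp (s * a) * Real.exp (-(p * (1 - Real.exp (-s)))) ^ n := by
      gcongr
      linarith [Real.add_one_le_exp (-(p * (1 - Real.exp (-s))))]
    _ = Real.exp (s * a - n * p * (1 - Real.exp (-s))) := by
      rw [← Real.exp_nat_mul, ← Real.exp_add]
      ring_nf

theorem stmt_6 (n : ℕ) (p : ℝ) (hp0 : 0 < p) (hp1 : p ≤ 1) (hn : (n : ℝ) ≥ 1 / p ^ 2) :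
    ∑ k ∈ Finset.range (n + 1),
        (if (k : ℝ) < n * p / 100 then (1 : ℝ) else 0) *
          ((n.choose k : ℝ) * p ^ k * (1 - p) ^ (n - k))
      ≤ 9 / 10 := by
  have hmean : 1 ≤ n * p := by
    have h : 1 ≤ n * p ^ 2 := (div_le_iff₀ (by positivity)).1 hn
    have h' : (n : ℝ) * p * p ≤ n * p * 1 := by gcongr
    linarith
  have exp_neg_one_le : Real.exp (-1) ≤ 1 / 2 := by
    linarith [Real.exp_neg_one_lt_d9]
  have exp_neg_le : Real.exp (-(49 / 100)) ≤ 9 / 10 := by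
    rw [Real.exp_neg]
    refine inv_le_of_inv_le₀ (by norm_num) ?_
    linarith [Real.add_one_le_exp (49 / 100 : ℝ)]
  refine (binomial_lower_tail_le_exp n hp0.le hp1 zero_le_one _).trans
    ((Real.exp_le_exp.2 ?_).trans exp_neg_le)
  nlinarith
end

section
/- Let K ≥ 1 and m ≥ 1 be natural numbers and let a_1, ..., a_K be natural numbers with a_k ≤ m for every k. Define N_k = ∑_{j<k} a_j (so N_1 = 0). Then ∑_{k=1}^{K} [N_k ≥ m] · a_k / N_k ≤ 2·log(K·m), where [N_k ≥ m] is 1 if N_k ≥ m and 0 otherwise, and log is the natural logarithm. -/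
theorem div_le_two_mul_log_add_sub_log {x y : ℝ} (hx : 0 ≤ x) (hxy : x ≤ y) (hy : 0 < y) :
    x / y ≤ 2 * (Real.log (y + x) - Real.log y) := by
  have hyx : 0 < y + x := by linarith
  have h := Real.one_sub_inv_le_log_of_pos (div_pos hyx hy)
  rw [Real.log_div hyx.ne' hy.ne', inv_div] at h
  have h' : x / y ≤ 2 * (1 - y / (y + x)) := by
    rw [one_sub_div hyx.ne', add_sub_cancel_left, ← mul_div_assoc, div_le_div_iff₀ hy hyx]
    nlinarith
  linarith

theorem sum_div_partial_sum_le_two_mul_log (m : ℕ) (hm : 1 ≤ m) (a : ℕ → ℕ)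
    (ha : ∀ k, a k ≤ m) (K : ℕ) :
    ∑ k ∈ Finset.Icc 1 K,
        (if m ≤ ∑ j ∈ Finset.Ico 1 k, a j then
          (a k : ℝ) / ((∑ j ∈ Finset.Ico 1 k, a j : ℕ) : ℝ)
        else 0)
      ≤ 2 * Real.log ((∑ j ∈ Finset.Ico 1 (K + 1), a j : ℕ) : ℝ) := by
  induction K with
  | zero => simp
  | succ K ih =>
    rw [Finset.sum_Icc_succ_top (by omega), Finset.sum_Ico_succ_top (b := K + 1) (by omega)]
    set N := ∑ j ∈ Finset.Ico 1 (K + 1), a j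
    split_ifs with h
    · have hstep := div_le_two_mul_log_add_sub_log (x := (a (K + 1) : ℝ)) (y := (N : ℝ))
        (by positivity) (by exact_mod_cast (ha _).trans h) (by exact_mod_cast hm.trans h)
      rw [Nat.cast_add]
      linarith
    · have hmono : Real.log (N : ℝ) ≤ Real.log ((N + a (K + 1) : ℕ) : ℝ) := by
        rcases Nat.eq_zero_or_pos N with h0 | hpos
        · simpa [h0] using Real.log_natCast_nonneg (a (K + 1))
        · exact Real.log_le_log (by exact_mod_cast hpos) (by push_cast; simp)
      linarith

theorem stmt_10 (K m : ℕ) (hK : 1 ≤ K) (hm : 1 ≤ m) (a : ℕ → ℕ)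
    (ha : ∀ k, a k ≤ m) :
    ∑ k ∈ Finset.Icc 1 K,
        (if m ≤ ∑ j ∈ Finset.Ico 1 k, a j then
          (a k : ℝ) / ((∑ j ∈ Finset.Ico 1 k, a j : ℕ) : ℝ)
        else 0)
      ≤ 2 * Real.log (K * m) := by
  refine (sum_div_partial_sum_le_two_mul_log m hm a ha K).trans ?_
  have hN : ∑ j ∈ Finset.Ico 1 (K + 1), a j ≤ K * m := by
    simpa using Finset.sum_le_card_nsmul (Finset.Ico 1 (K + 1)) a m fun k _ => ha k
  rw [← Nat.cast_mul]
  rcases Nat.eq_zero_or_pos (∑ j ∈ Finset.Ico 1 (K + 1), a j) with h0 | hpos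
  · rw [h0]
    simpa only [Nat.cast_zero, Real.log_zero, mul_zero] using
      mul_nonneg zero_le_two (Real.log_natCast_nonneg (K * m))
  · gcongr
end
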